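/- For every sequence (M_n)_{n∈ℕ} ∈ {C1,C2}^ℕ there exists a nonzero vector u ∈ ℝ³_{≥0} such that ⋂_{n≥0} M_{[0,n)} ℝ³_{≥0} = ℝ_{≥0} u; that is, every such sequence of matrices is weakly convergent (the nested cones intersect in a single ray). -/

import Mathlib

open Matrix Filter MeasureTheory

noncomputable section

/-- The matrix `C1`. -/
def C1 : Matrix (Fin 3) (Fin 3) ℝ := !![1,1,0; 0,0,1; 0,1,0]

/-- The matrix `C2`. -/
def C2 : Matrix (Fin 3) (Fin 3) ℝ := !![0,1,0; 1,0,0; 0,1,1]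

/-- The product `M 0 * M 1 * ... * M (n-1)`. -/
def pprod (M : ℕ → Matrix (Fin 3) (Fin 3) ℝ) (n : ℕ) : Matrix (Fin 3) (Fin 3) ℝ :=
  ((List.range n).map M).prod

/-- The image of the nonnegative orthant under `M`. -/
def cone (M : Matrix (Fin 3) (Fin 3) ℝ) : Set (Fin 3 → ℝ) :=
  {y | ∃ x : Fin 3 → ℝ, (∀ i, 0 ≤ x i) ∧ y = M.mulVec x}

/-- The ray generated by `f`. -/
def ray (f : Fin 3 → ℝ) : Set (Fin 3 → ℝ) := {y | ∃ t : ℝ, 0 ≤ t ∧ y = t • f}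

/-- The action of `C1` on row vectors. -/
def StepLeft (x y : Fin 3 → ℝ) : Prop := y 0 = x 0 ∧ y 1 = x 0 + x 2 ∧ y 2 = x 1

/-- The action of `C2` on row vectors. -/
def StepRight (x y : Fin 3 → ℝ) : Prop := y 0 = x 1 ∧ y 1 = x 0 + x 2 ∧ y 2 = x 2

/-- The row vectors `h` and `v` evolve under a common sequence of matrices `C1`, `C2`. -/
def CommonSteps (h v : ℕ → Fin 3 → ℝ) : Prop :=
  ∀ n, (StepLeft (h n) (h (n + 1)) ∧ StepLeft (v n) (v (n + 1))) ∨
    (StepRight (h n) (h (n + 1)) ∧ StepRight (v n) (v (n + 1)))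

/-- The ratios `v j / h j` lie in an interval of length `d`. -/
def SlopesWithin (h v : Fin 3 → ℝ) (d : ℝ) : Prop :=
  ∃ l : ℝ, ∀ j, l * h j ≤ v j ∧ v j ≤ (l + d) * h j

/-- Positive lengths for which the middle one is maximal and at most the sum of the others. -/
def BalancedLengths (h : Fin 3 → ℝ) : Prop :=
  0 < h 0 ∧ 0 < h 2 ∧ h 0 ≤ h 1 ∧ h 2 ≤ h 1 ∧ h 1 ≤ h 0 + h 2

/-- The two outer lengths differ by a factor at most two. -/
def Comparable (h : Fin 3 → ℝ) : Prop := h 0 ≤ 2 * h 2 ∧ h 2 ≤ 2 * h 0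

lemma SlopesWithin.step {h v h' v' : Fin 3 → ℝ} {d : ℝ} (hs : SlopesWithin h v d)
    (hst : (StepLeft h h' ∧ StepLeft v v') ∨ (StepRight h h' ∧ StepRight v v')) :
    SlopesWithin h' v' d := by
  obtain ⟨l, hl⟩ := hs
  have h0 := hl 0
  have h1 := hl 1
  have h2 := hl 2
  refine ⟨l, fun j => ?_⟩
  rcases hst with ⟨⟨a0, a1, a2⟩, b0, b1, b2⟩ | ⟨⟨a0, a1, a2⟩, b0, b1, b2⟩ <;>
    fin_cases j <;> simp only [Fin.zero_eta, Fin.mk_one, Fin.reduceFinMk, a0, a1, a2, b0, b1, b2] <;>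
    constructor <;> linarith

lemma SlopesWithin.mono_index {h v : ℕ → Fin 3 → ℝ} (hc : CommonSteps h v) {d : ℝ} {n m : ℕ}
    (hnm : n ≤ m) (hs : SlopesWithin (h n) (v n) d) : SlopesWithin (h m) (v m) d := by
  induction m, hnm using Nat.le_induction with
  | base => exact hs
  | succ m _ ih => exact ih.step (hc m)

lemma CommonSteps.balanced {h v : ℕ → Fin 3 → ℝ} (hc : CommonSteps h v) (h0 : BalancedLengths (h 0))
    (n : ℕ) : BalancedLengths (h n) := by
  induction n with
  | zero => exact h0
  | succ n ih =>
    obtain ⟨i1, i2, i3, i4, i5⟩ := ih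
    rcases hc n with ⟨⟨a0, a1, a2⟩, -⟩ | ⟨⟨a0, a1, a2⟩, -⟩ <;>
      refine ⟨?_, ?_, ?_, ?_, ?_⟩ <;> linarith

/-- If every vector of a triple contains a proportion at least `δ` of a common pivot `(a, x)`,
then the interval of slopes shrinks by the factor `1 - δ`. -/
lemma slopesWithin_of_pivot {a x l d δ : ℝ} (ha : 0 < a) (hx : l * a ≤ x) (hx' : x ≤ (l + d) * a)
    {h v : Fin 3 → ℝ}
    (hp : ∀ j, ∃ k, δ * h j ≤ k * a ∧ l * (h j - k * a) ≤ v j - k * x ∧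
      v j - k * x ≤ (l + d) * (h j - k * a)) :
    SlopesWithin h v ((1 - δ) * d) := by
  obtain ⟨w, rfl⟩ : ∃ w, x = (l + w) * a := ⟨x / a - l, by field_simp; ring⟩
  have hw : 0 ≤ w := by nlinarith
  have hw' : w ≤ d := by nlinarith
  refine ⟨l + δ * w, fun j => ?_⟩
  obtain ⟨k, h1, h2, h3⟩ := hp j
  constructor
  · nlinarith [mul_le_mul_of_nonneg_right h1 hw]
  · nlinarith [mul_le_mul_of_nonneg_right h1 (sub_nonneg.2 hw')]

lemma SlopesWithin.contract_of_comparable {h v : ℕ → Fin 3 → ℝ} (hc : CommonSteps h v) {n : ℕ}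
    (hb : BalancedLengths (h n)) (hcomp : Comparable (h n)) {d : ℝ} (hs : SlopesWithin (h n) (v n) d) :
    SlopesWithin (h (n + 3)) (v (n + 3)) (5 / 6 * d) := by
  obtain ⟨l, hl⟩ := hs
  obtain ⟨p0, p2, p3, p4, p5⟩ := hb
  obtain ⟨c0, c2⟩ := hcomp
  have l0 := hl 0
  have l1 := hl 1
  have l2 := hl 2
  have key : ∀ i : Fin 3, (∀ j, h (n + 3) j ≤ 6 * h n i ∧
      l * (h (n + 3) j - h n i) ≤ v (n + 3) j - v n i ∧
      v (n + 3) j - v n i ≤ (l + d) * (h (n + 3) j - h n i)) →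
      SlopesWithin (h (n + 3)) (v (n + 3)) (5 / 6 * d) := by
    intro i hi
    have hpos : 0 < h n i := by fin_cases i <;> simp <;> linarith
    have := slopesWithin_of_pivot (δ := 1 / 6) hpos (hl i).1 (hl i).2
      (h := h (n + 3)) (v := v (n + 3)) fun j => ⟨1, by linarith [(hi j).1],
        by simpa using (hi j).2.1, by simpa using (hi j).2.2⟩
    convert this using 2
    norm_num
  have e1 := hc n
  have e2 := hc (n + 1)
  have e3 := hc (n + 2)
  simp only [StepLeft, StepRight, add_assoc, Nat.reduceAdd] at e1 e2 e3
  rcases e1 with ⟨⟨a0, a1, a2⟩, b0, b1, b2⟩ | ⟨⟨a0, a1, a2⟩, b0, b1, b2⟩ <;>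
    rcases e2 with ⟨⟨a3, a4, a5⟩, b3, b4, b5⟩ | ⟨⟨a3, a4, a5⟩, b3, b4, b5⟩ <;>
    rcases e3 with ⟨⟨a6, a7, a8⟩, b6, b7, b8⟩ | ⟨⟨a6, a7, a8⟩, b6, b7, b8⟩
  on_goal 1 => refine key 0 fun j => ?_
  on_goal 2 => refine key 0 fun j => ?_
  on_goal 3 => refine key 0 fun j => ?_
  on_goal 4 => refine key 1 fun j => ?_
  on_goal 5 => refine key 1 fun j => ?_
  on_goal 6 => refine key 2 fun j => ?_
  on_goal 7 => refine key 2 fun j => ?_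
  on_goal 8 => refine key 2 fun j => ?_
  all_goals
    fin_cases j <;> simp only [Fin.zero_eta, Fin.mk_one, Fin.reduceFinMk, a0, a1, a2, b0, b1, b2,
      a3, a4, a5, b3, b4, b5, a6, a7, a8, b6, b7, b8] <;>
    refine ⟨?_, ?_, ?_⟩ <;> linarith

lemma exists_contract_of_not_comparable {h v : ℕ → Fin 3 → ℝ} (hc : CommonSteps h v)
    (hb : ∀ n, BalancedLengths (h n)) {n : ℕ} (hn : ∀ m, n ≤ m → ¬ Comparable (h m))
    (hlt : 2 * h n 2 < h n 0) {d : ℝ} (hs : SlopesWithin (h n) (v n) d) :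
    ∃ m, SlopesWithin (h m) (v m) (5 / 6 * d) := by
  have hinv : ∀ k, 2 * h (n + k) 2 < h (n + k) 0 ∧
      StepRight (h (n + k)) (h (n + k + 1)) ∧ StepRight (v (n + k)) (v (n + k + 1)) := by
    have hstep : ∀ k, 2 * h (n + k) 2 < h (n + k) 0 →
        StepRight (h (n + k)) (h (n + k + 1)) ∧ StepRight (v (n + k)) (v (n + k + 1)) := by
      intro k hk
      refine (hc (n + k)).resolve_left fun ⟨⟨a0, a1, a2⟩, _⟩ => hn (n + k + 1) (by omega) ?_
      obtain ⟨i1, i2, i3, i4, i5⟩ := hb (n + k)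
      constructor <;> linarith
    intro k
    induction k with
    | zero => exact ⟨hlt, hstep 0 hlt⟩
    | succ k ih =>
      obtain ⟨i1, i2, i3, i4, i5⟩ := hb (n + k)
      obtain ⟨h1, ⟨a0, a1, a2⟩, _⟩ := ih
      have hlt' : 2 * h (n + (k + 1)) 2 < h (n + (k + 1)) 0 := by
        rw [← add_assoc]; linarith
      exact ⟨hlt', hstep (k + 1) hlt'⟩
  have hform : ∀ k : ℕ,
      (h (n + 2 * k) 0 = h n 0 + k * h n 2 ∧ h (n + 2 * k) 1 = h n 1 + k * h n 2 ∧
        h (n + 2 * k) 2 = h n 2) ∧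
      (v (n + 2 * k) 0 = v n 0 + k * v n 2 ∧ v (n + 2 * k) 1 = v n 1 + k * v n 2 ∧
        v (n + 2 * k) 2 = v n 2) := by
    intro k
    induction k with
    | zero => simp
    | succ k ih =>
      obtain ⟨⟨a0, a1, a2⟩, b0, b1, b2⟩ := ih
      obtain ⟨-, ⟨c0, c1, c2⟩, d0, d1, d2⟩ := hinv (2 * k)
      obtain ⟨-, ⟨e0, e1, e2⟩, f0, f1, f2⟩ := hinv (2 * k + 1)
      simp only [← add_assoc] at e0 e1 e2 f0 f1 f2
      rw [show n + 2 * (k + 1) = n + 2 * k + 1 + 1 by ring]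
      push_cast
      refine ⟨⟨?_, ?_, ?_⟩, ?_, ?_, ?_⟩ <;> linarith
  obtain ⟨i1, i2, i3, i4, i5⟩ := hb n
  obtain ⟨k, hk⟩ := exists_nat_ge (5 * h n 1 / h n 2)
  rw [div_le_iff₀ i2] at hk
  obtain ⟨⟨a0, a1, a2⟩, b0, b1, b2⟩ := hform k
  obtain ⟨l, hl⟩ := hs
  refine ⟨n + 2 * k, ?_⟩
  have l0 := hl 0
  have l1 := hl 1
  have l2 := hl 2
  have hpiv := slopesWithin_of_pivot (δ := 1 / 6) i2 l2.1 l2.2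
    (h := h (n + 2 * k)) (v := v (n + 2 * k)) fun j => by
      fin_cases j <;> simp only [Fin.zero_eta, Fin.mk_one, Fin.reduceFinMk, a0, a1, a2, b0, b1, b2]
      on_goal 3 => use 1
      on_goal 1 => use k
      on_goal 2 => use k
      all_goals refine ⟨?_, ?_, ?_⟩ <;> linarith
  convert hpiv using 2
  norm_num

lemma CommonSteps.rev {h v : ℕ → Fin 3 → ℝ} (hc : CommonSteps h v) :
    CommonSteps (fun n => h n ∘ Fin.rev) (fun n => v n ∘ Fin.rev) := by
  intro n
  have e0 : Fin.rev (0 : Fin 3) = 2 := rfl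
  have e1 : Fin.rev (1 : Fin 3) = 1 := rfl
  have e2 : Fin.rev (2 : Fin 3) = 0 := rfl
  have := hc n
  simp only [StepLeft, StepRight, Function.comp_apply, e0, e1, e2] at this ⊢
  rcases this with ⟨⟨a0, a1, a2⟩, b0, b1, b2⟩ | ⟨⟨a0, a1, a2⟩, b0, b1, b2⟩
  · right
    refine ⟨⟨?_, ?_, ?_⟩, ?_, ?_, ?_⟩ <;> linarith
  · left
    refine ⟨⟨?_, ?_, ?_⟩, ?_, ?_, ?_⟩ <;> linarith

lemma SlopesWithin.rev {h v : Fin 3 → ℝ} {d : ℝ} (hs : SlopesWithin h v d) :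
    SlopesWithin (h ∘ Fin.rev) (v ∘ Fin.rev) d :=
  let ⟨l, hl⟩ := hs
  ⟨l, fun j => hl j.rev⟩

lemma BalancedLengths.rev {h : Fin 3 → ℝ} (hb : BalancedLengths h) : BalancedLengths (h ∘ Fin.rev) := by
  obtain ⟨i1, i2, i3, i4, i5⟩ := hb
  exact ⟨i2, i1, i4, i3, by rw [add_comm] at i5; exact i5⟩

lemma exists_contract {h v : ℕ → Fin 3 → ℝ} (hc : CommonSteps h v) (hb : ∀ n, BalancedLengths (h n))
    {n : ℕ} {d : ℝ} (hs : SlopesWithin (h n) (v n) d) :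
    ∃ m, SlopesWithin (h m) (v m) (5 / 6 * d) := by
  by_cases hn : ∃ m, n ≤ m ∧ Comparable (h m)
  · obtain ⟨m, hnm, hm⟩ := hn
    exact ⟨m + 3, (hs.mono_index hc hnm).contract_of_comparable hc (hb m) hm⟩
  push Not at hn
  by_cases hlt : 2 * h n 2 < h n 0
  · exact exists_contract_of_not_comparable hc hb hn hlt hs
  · have hlt' : 2 * h n 0 < h n 2 := by
      by_contra hcon
      exact hn n le_rfl ⟨not_lt.1 hlt, not_lt.1 hcon⟩
    obtain ⟨m, hm⟩ := exists_contract_of_not_comparable hc.rev (fun n => (hb n).rev)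
      (fun m hm hcm => hn m hm ⟨hcm.2, hcm.1⟩) hlt' hs.rev
    refine ⟨m, ?_⟩
    simpa [Function.comp_assoc, Fin.rev_involutive.comp_self] using hm.rev

lemma exists_slopesWithin {h v : ℕ → Fin 3 → ℝ} (hc : CommonSteps h v) (hb : BalancedLengths (h 0))
    (hs : SlopesWithin (h 0) (v 0) 1) {ε : ℝ} (hε : 0 < ε) :
    ∃ n, ∃ d ≤ ε, SlopesWithin (h n) (v n) d := by
  have hpow : ∀ k : ℕ, ∃ n, SlopesWithin (h n) (v n) ((5 / 6) ^ k) := by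
    intro k
    induction k with
    | zero => exact ⟨0, by simpa using hs⟩
    | succ k ih =>
      obtain ⟨n, hn⟩ := ih
      rw [pow_succ']
      exact exists_contract hc (hc.balanced hb) hn
  obtain ⟨k, hk⟩ := exists_pow_lt_of_lt_one hε (show (5 / 6 : ℝ) < 1 by norm_num)
  obtain ⟨n, hn⟩ := hpow k
  exact ⟨n, _, hk.le, hn⟩

lemma pprod_succ (M : ℕ → Matrix (Fin 3) (Fin 3) ℝ) (n : ℕ) :
    pprod M (n + 1) = pprod M n * M n := by
  simp [pprod, List.range_succ]

section

variable {M : ℕ → Matrix (Fin 3) (Fin 3) ℝ}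

lemma commonSteps_pprod (hM : ∀ n, M n = C1 ∨ M n = C2) (i : Fin 3) :
    CommonSteps (fun n j => ∑ i, pprod M n i j) (fun n => pprod M n i) := by
  intro n
  rcases hM n with h | h
  · left
    simp [StepLeft, pprod_succ, h, C1, Matrix.mul_apply, Fin.sum_univ_three]
    ring
  · right
    simp [StepRight, pprod_succ, h, C2, Matrix.mul_apply, Fin.sum_univ_three]
    ring

lemma balanced_pprod_zero : BalancedLengths (fun j => ∑ i, pprod M 0 i j) := by
  norm_num [BalancedLengths, pprod, Fin.sum_univ_three, Matrix.one_apply]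

lemma slopesWithin_pprod_zero (i : Fin 3) :
    SlopesWithin (fun j => ∑ i, pprod M 0 i j) (pprod M 0 i) 1 := by
  refine ⟨0, fun j => ?_⟩
  fin_cases i <;> fin_cases j <;> norm_num [pprod, Fin.sum_univ_three, Matrix.one_apply]

lemma cone_pprod_succ_subset (hM : ∀ n, M n = C1 ∨ M n = C2) (n : ℕ) :
    cone (pprod M (n + 1)) ⊆ cone (pprod M n) := by
  rintro _ ⟨x, hx, rfl⟩
  refine ⟨M n *ᵥ x, fun i => ?_, by rw [pprod_succ, Matrix.mulVec_mulVec]⟩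
  have h0 := hx 0
  have h1 := hx 1
  have h2 := hx 2
  rcases hM n with h | h <;> rw [h] <;> fin_cases i <;>
    simp [C1, C2, Matrix.mulVec, dotProduct, Fin.sum_univ_three] <;> linarith

lemma nonneg_of_mem_cone_pprod (hM : ∀ n, M n = C1 ∨ M n = C2) {n : ℕ} {y : Fin 3 → ℝ}
    (hy : y ∈ cone (pprod M n)) (i : Fin 3) : 0 ≤ y i := by
  obtain ⟨x, hx, rfl⟩ := antitone_nat_of_succ_le (f := fun n => cone (pprod M n)) (cone_pprod_succ_subset hM)
    (Nat.zero_le n) hy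
  simpa [pprod] using hx i

lemma isUnit_det_pprod (hM : ∀ n, M n = C1 ∨ M n = C2) (n : ℕ) : IsUnit (pprod M n).det := by
  induction n with
  | zero => simp [pprod]
  | succ n ih =>
    rw [pprod_succ, Matrix.det_mul]
    refine ih.mul ?_
    rcases hM n with h | h <;> rw [h] <;> simp [C1, C2, Matrix.det_fin_three]

lemma isClosed_cone {A : Matrix (Fin 3) (Fin 3) ℝ} (hA : IsUnit A.det) : IsClosed (cone A) := by
  have : cone A = {y | ∀ i, 0 ≤ (A⁻¹ *ᵥ y) i} := by
    ext y
    constructor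
    · rintro ⟨x, hx, rfl⟩ i
      simpa [Matrix.mulVec_mulVec, Matrix.nonsing_inv_mul A hA] using hx i
    · intro hy
      exact ⟨A⁻¹ *ᵥ y, hy, by simp [Matrix.mulVec_mulVec, Matrix.mul_nonsing_inv A hA]⟩
  rw [this, Set.ofPred_forall]
  refine isClosed_iInter fun i => isClosed_le continuous_const ?_
  exact (continuous_apply i).comp (continuous_const.matrix_mulVec continuous_id)

lemma smul_mem_cone {A : Matrix (Fin 3) (Fin 3) ℝ} {y : Fin 3 → ℝ} (hy : y ∈ cone A) {t : ℝ}
    (ht : 0 ≤ t) : t • y ∈ cone A := by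
  obtain ⟨x, hx, rfl⟩ := hy
  exact ⟨t • x, fun i => mul_nonneg ht (hx i), by rw [Matrix.mulVec_smul]⟩

lemma bounds_of_mem_cone {A : Matrix (Fin 3) (Fin 3) ℝ} {y : Fin 3 → ℝ} (hy : y ∈ cone A)
    {i : Fin 3} {l d : ℝ}
    (hl : ∀ j, l * (∑ i, A i j) ≤ A i j ∧ A i j ≤ (l + d) * ∑ i, A i j) :
    l * ∑ i, y i ≤ y i ∧ y i ≤ (l + d) * ∑ i, y i := by
  obtain ⟨x, hx, rfl⟩ := hy
  have hsum : ∑ i, (A *ᵥ x) i = ∑ j, (∑ i, A i j) * x j := by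
    simp only [Matrix.mulVec, dotProduct, Finset.sum_mul]
    exact Finset.sum_comm
  rw [hsum, Finset.mul_sum, Finset.mul_sum, show (A *ᵥ x) i = ∑ j, A i j * x j from rfl]
  constructor <;> refine Finset.sum_le_sum fun j _ => ?_ <;> rw [← mul_assoc]
  · exact mul_le_mul_of_nonneg_right (hl j).1 (hx j)
  · exact mul_le_mul_of_nonneg_right (hl j).2 (hx j)

lemma exists_mem_stdSimplex_cone_pprod (hM : ∀ n, M n = C1 ∨ M n = C2) :
    ∃ u ∈ stdSimplex ℝ (Fin 3), ∀ n, u ∈ cone (pprod M n) := by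
  have hne : (⋂ n, cone (pprod M n) ∩ stdSimplex ℝ (Fin 3)).Nonempty := by
    refine IsCompact.nonempty_iInter_of_sequence_nonempty_isCompact_isClosed _
      (fun n => Set.inter_subset_inter_left _ (cone_pprod_succ_subset hM n)) (fun n => ?_)
      ((isCompact_stdSimplex ℝ (Fin 3)).inter_left (isClosed_cone (isUnit_det_pprod hM 0)))
      (fun n => (isClosed_cone (isUnit_det_pprod hM n)).inter (isClosed_stdSimplex ℝ (Fin 3)))
    have hpos : 0 < ∑ i, pprod M n i 0 :=
      ((commonSteps_pprod hM 0).balanced balanced_pprod_zero n).1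
    have hmem : (∑ i, pprod M n i 0)⁻¹ • (pprod M n *ᵥ Pi.single 0 1) ∈ cone (pprod M n) :=
      smul_mem_cone ⟨Pi.single 0 1, fun i => by fin_cases i <;> simp, rfl⟩ (inv_nonneg.2 hpos.le)
    refine ⟨_, hmem, nonneg_of_mem_cone_pprod hM hmem, ?_⟩
    simp only [Pi.smul_apply, smul_eq_mul, Matrix.mulVec_single_one, Matrix.col_apply,
      ← Finset.mul_sum]
    exact inv_mul_cancel₀ hpos.ne'
  obtain ⟨u, hu⟩ := hne
  rw [Set.mem_iInter] at hu
  exact ⟨u, (hu 0).2, fun n => (hu n).1⟩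

lemma eq_smul_of_mem_cone_pprod (hM : ∀ n, M n = C1 ∨ M n = C2) {u y : Fin 3 → ℝ}
    (hu : ∀ n, u ∈ cone (pprod M n)) (hu1 : ∑ i, u i = 1) (hy : ∀ n, y ∈ cone (pprod M n)) :
    y = (∑ i, y i) • u := by
  have hs : 0 ≤ ∑ i, y i := Finset.sum_nonneg fun i _ => nonneg_of_mem_cone_pprod hM (hy 0) i
  ext i
  rw [Pi.smul_apply, smul_eq_mul, ← sub_eq_zero, ← abs_nonpos_iff]
  refine le_of_forall_pos_le_add fun ε hε => ?_
  obtain ⟨n, d, hd, l, hl⟩ := exists_slopesWithin (commonSteps_pprod hM i) balanced_pprod_zero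
    (slopesWithin_pprod_zero i) (div_pos hε (show 0 < ∑ i, y i + 1 by linarith))
  rw [le_div_iff₀ (by linarith)] at hd
  obtain ⟨hu2, hu3⟩ := bounds_of_mem_cone (hu n) hl
  obtain ⟨hy2, hy3⟩ := bounds_of_mem_cone (hy n) hl
  rw [hu1, mul_one] at hu2 hu3
  have h1 := mul_le_mul_of_nonneg_left hu2 hs
  have h2 := mul_le_mul_of_nonneg_left hu3 hs
  rw [zero_add, abs_le]
  constructor <;> nlinarith

end

theorem weak_convergence (M : ℕ → Matrix (Fin 3) (Fin 3) ℝ)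
    (hM : ∀ n, M n = C1 ∨ M n = C2) :
    ∃ u : Fin 3 → ℝ, u ≠ 0 ∧ (∀ i, 0 ≤ u i) ∧
      (⋂ n : ℕ, cone (pprod M n)) = ray u := by
  obtain ⟨u, ⟨hu0, hu1⟩, hu⟩ := exists_mem_stdSimplex_cone_pprod hM
  refine ⟨u, ?_, hu0, ?_⟩
  · rintro rfl
    simp at hu1
  ext y
  rw [Set.mem_iInter]
  constructor
  · intro hy
    exact ⟨_, Finset.sum_nonneg fun i _ => nonneg_of_mem_cone_pprod hM (hy 0) i,
      eq_smul_of_mem_cone_pprod hM hu hu1 hy⟩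
  · rintro ⟨t, ht, rfl⟩ n
    exact smul_mem_cone (hu n) ht
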